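/- For every x ∈ ℝ: L₁(x) > 0, L₂(x) > 0, L₁′(x) < 0, L₂′(x) > 0, and consequently the Wronskian-type quantity L₁(x)·L₂′(x) − L₂(x)·L₁′(x) is strictly positive (in particular nonzero). -/

import Mathlib

open Real MeasureTheory Filter Topology

/-- The density `z ^ s * exp (-b z² + t z)` is integrable on the positive half-line. -/
lemma integrableOn_rpow_mul_exp_quadratic {b s : ℝ} (hb : 0 < b) (hs : -1 < s) (t : ℝ) :
    IntegrableOn (fun z : ℝ => z ^ s * Real.exp (-b * z ^ 2 + t * z)) (Set.Ioi 0) := by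
  have hdom : IntegrableOn
      (fun z : ℝ => Real.exp (t ^ 2 / (2 * b)) * (z ^ s * Real.exp (-(b / 2) * z ^ 2)))
      (Set.Ioi 0) :=
    (integrableOn_rpow_mul_exp_neg_mul_sq (half_pos hb) hs).const_mul _
  refine Integrable.mono' hdom (by fun_prop) ?_
  filter_upwards [ae_restrict_mem measurableSet_Ioi] with z hz
  have hz : 0 < z := hz
  rw [Real.norm_of_nonneg (by positivity), mul_left_comm, ← Real.exp_add]
  refine mul_le_mul_of_nonneg_left (Real.exp_le_exp.mpr ?_) (by positivity)
  have hsq : 0 ≤ (b * z - t) ^ 2 / (2 * b) := by positivity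
  have hid : (b * z - t) ^ 2 / (2 * b) = b / 2 * z ^ 2 - t * z + t ^ 2 / (2 * b) := by
    field_simp
    ring
  linarith

lemma integral_rpow_mul_exp_quadratic_pos {b s : ℝ} (hb : 0 < b) (hs : -1 < s) (t : ℝ) :
    0 < ∫ z in Set.Ioi (0 : ℝ), z ^ s * Real.exp (-b * z ^ 2 + t * z) := by
  have hpos : ∀ z ∈ Set.Ioi (0 : ℝ), 0 < z ^ s * Real.exp (-b * z ^ 2 + t * z) := by
    intro z hz
    have hz : 0 < z := hz
    positivity
  rw [setIntegral_pos_iff_support_of_nonneg_ae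
    ((ae_restrict_mem measurableSet_Ioi).mono fun z hz => (hpos z hz).le)
    (integrableOn_rpow_mul_exp_quadratic hb hs t),
    Set.inter_eq_right.mpr fun z hz => Function.mem_support.mpr (hpos z hz).ne']
  simp

lemma hasDerivAt_integral_rpow_mul_exp_quadratic {b s : ℝ} (hb : 0 < b) (hs : -1 < s) (t : ℝ) :
    HasDerivAt (fun t => ∫ z in Set.Ioi (0 : ℝ), z ^ s * Real.exp (-b * z ^ 2 + t * z))
      (∫ z in Set.Ioi (0 : ℝ), z ^ (s + 1) * Real.exp (-b * z ^ 2 + t * z)) t := by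
  refine (hasDerivAt_integral_of_dominated_loc_of_deriv_le
    (μ := volume.restrict (Set.Ioi 0))
    (F := fun t z => z ^ s * Real.exp (-b * z ^ 2 + t * z))
    (F' := fun t z => z ^ (s + 1) * Real.exp (-b * z ^ 2 + t * z))
    (bound := fun z => z ^ (s + 1) * Real.exp (-b * z ^ 2 + (t + 1) * z))
    (Metric.ball_mem_nhds t one_pos) (.of_forall fun _ => by fun_prop)
    (integrableOn_rpow_mul_exp_quadratic hb hs t) (by fun_prop) ?_
    (integrableOn_rpow_mul_exp_quadratic hb (by linarith) (t + 1)) ?_).2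
  · filter_upwards [ae_restrict_mem measurableSet_Ioi] with z hz u hu
    have hz : 0 < z := hz
    rw [Real.norm_of_nonneg (by positivity)]
    have hu : u ≤ t + 1 := by
      have := (abs_lt.mp (Metric.mem_ball.mp hu)).2
      linarith
    gcongr
  · filter_upwards [ae_restrict_mem measurableSet_Ioi] with z hz u _
    have hz : 0 < z := hz
    have hlin : HasDerivAt (fun u : ℝ => -b * z ^ 2 + u * z) z u := by
      simpa using ((hasDerivAt_id u).mul_const z).const_add (-b * z ^ 2)
    refine (hlin.exp.const_mul (z ^ s)).congr_deriv ?_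
    rw [Real.rpow_add_one hz.ne']
    ring

/-- For every `x ∈ ℝ`: `L₁(x) > 0`, `L₂(x) > 0`, `L₁'(x) < 0`,
`L₂'(x) > 0`, and the Wronskian-type quantity
`L₁(x) L₂'(x) − L₂(x) L₁'(x)` is strictly positive. -/
theorem stmt13 (κ μ σ q : ℝ) (hκ : 0 < κ) (hσ : 0 < σ) (hq : 0 < q)
    (L₁ L₂ : ℝ → ℝ)
    (hL₁ : ∀ x : ℝ, L₁ x = ∫ z in Set.Ioi (0 : ℝ),
      z ^ (q / κ - 1) * Real.exp (-σ ^ 2 * z ^ 2 / (4 * κ) + μ * z / κ)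
        * Real.exp (-x * z))
    (hL₂ : ∀ x : ℝ, L₂ x = ∫ z in Set.Iio (0 : ℝ),
      |z| ^ (q / κ - 1) * Real.exp (-σ ^ 2 * z ^ 2 / (4 * κ) + μ * z / κ)
        * Real.exp (-x * z)) :
    ∀ x : ℝ,
      0 < L₁ x ∧ 0 < L₂ x ∧ deriv L₁ x < 0 ∧ 0 < deriv L₂ x ∧
      0 < L₁ x * deriv L₂ x - L₂ x * deriv L₁ x := by
  have hb : 0 < σ ^ 2 / (4 * κ) := by positivity
  have hs : -1 < q / κ - 1 := by linarith [div_pos hq hκ]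
  set b := σ ^ 2 / (4 * κ) with hb_def
  set s := q / κ - 1
  have hL₁' : L₁ = fun x => ∫ z in Set.Ioi (0 : ℝ),
      z ^ s * Real.exp (-b * z ^ 2 + (μ / κ - x) * z) := by
    funext x
    rw [hL₁]
    congr 1 with z
    rw [mul_assoc, ← Real.exp_add, hb_def]
    ring_nf
  have hL₂' : L₂ = fun x => ∫ z in Set.Ioi (0 : ℝ),
      z ^ s * Real.exp (-b * z ^ 2 + (x - μ / κ) * z) := by
    funext x
    rw [hL₂, ← integral_Iic_eq_integral_Iio, ← neg_zero, ← integral_comp_neg_Ioi, neg_zero]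
    refine setIntegral_congr_fun measurableSet_Ioi fun z hz => ?_
    have hz : 0 < z := hz
    simp only [abs_neg, abs_of_pos hz]
    rw [mul_assoc, ← Real.exp_add, hb_def]
    ring_nf
  intro x
  have hd₁ : deriv L₁ x = (∫ z in Set.Ioi (0 : ℝ),
      z ^ (s + 1) * Real.exp (-b * z ^ 2 + (μ / κ - x) * z)) * -1 := by
    rw [hL₁']
    exact ((hasDerivAt_integral_rpow_mul_exp_quadratic hb hs (μ / κ - x)).comp x
      ((hasDerivAt_id x).const_sub (μ / κ))).deriv
  have hd₂ : deriv L₂ x = (∫ z in Set.Ioi (0 : ℝ),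
      z ^ (s + 1) * Real.exp (-b * z ^ 2 + (x - μ / κ) * z)) * 1 := by
    rw [hL₂']
    exact ((hasDerivAt_integral_rpow_mul_exp_quadratic hb hs (x - μ / κ)).comp x
      ((hasDerivAt_id x).sub_const (μ / κ))).deriv
  have hs' : -1 < s + 1 := by linarith
  have h₁ : 0 < L₁ x := hL₁' ▸ integral_rpow_mul_exp_quadratic_pos hb hs (μ / κ - x)
  have h₂ : 0 < L₂ x := hL₂' ▸ integral_rpow_mul_exp_quadratic_pos hb hs (x - μ / κ)
  have h₁' : deriv L₁ x < 0 := by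
    rw [hd₁]
    linarith [integral_rpow_mul_exp_quadratic_pos hb hs' (μ / κ - x)]
  have h₂' : 0 < deriv L₂ x := by
    rw [hd₂]
    linarith [integral_rpow_mul_exp_quadratic_pos hb hs' (x - μ / κ)]
  exact ⟨h₁, h₂, h₁', h₂', by nlinarith [mul_pos h₁ h₂', mul_neg_of_pos_of_neg h₂ h₁']⟩
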